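/- arXiv:1511.09305 — 2 statements merged into one kernel-verified Lean document; each statement's English description precedes it below -/
import Mathlib

section
/- For every y ≥ 2 and all real σ, κ > 0: ∂₂₀f_y(σ,κ) + ∂₁₁f_y(σ,κ) > 0 and Hess[f_y](σ,κ) := ∂₂₀f_y(σ,κ)·∂₀₂f_y(σ,κ) − (∂₁₁f_y(σ,κ))² > 0. -/
open Complex Finset MeasureTheory
open scoped Real Classical

noncomputable section

/-- The set of primes `p ≤ y`. -/
def primesLe (y : ℝ) : Finset ℕ := (Finset.Iic ⌊y⌋₊).filter Nat.Prime

/-- `α` satisfies the saddle-point equation `∑_{p ≤ y} log p/(p^α − 1) = log x`. -/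
def saddleEq (x y α : ℝ) : Prop :=
  ∑ p ∈ primesLe y, Real.log p / ((p : ℝ) ^ α - 1) = Real.log x

/-- `ū = min{u, π(y)}` where `u = log x/log y`. -/
def ubar (x y : ℝ) : ℝ := min (Real.log x / Real.log y) ((primesLe y).card)

def sigma2 (y α : ℝ) : ℝ :=
  ∑ p ∈ primesLe y, (Real.log p) ^ 2 * (p : ℝ) ^ α / ((p : ℝ) ^ α - 1) ^ 2

def sigma2t (y α : ℝ) : ℝ :=
  ∑ p ∈ primesLe y, (Real.log p) ^ 2 / ((p : ℝ) ^ α - 1) ^ 2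

/-- `ϱ = (1/2)(σ₂ − σ̃₂/3)^{1/2}`. -/
def rhoXY (y α : ℝ) : ℝ := (1 / 2) * Real.sqrt (sigma2 y α - sigma2t y α / 3)

/-- `n` is `y`-friable: every prime factor of `n` is at most `y`. -/
def friable (y : ℝ) (n : ℕ) : Prop := ∀ p : ℕ, p.Prime → p ∣ n → (p : ℝ) ≤ y

/-- `S(x,y)`: the set of `y`-friable integers `1 ≤ n ≤ x`. -/
def Sxy (x y : ℝ) : Finset ℕ := (Finset.Icc 1 ⌊x⌋₊).filter (friable y)

/-- `Ψ(x,y) = #S(x,y)`. -/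
def Psi (x y : ℝ) : ℕ := (Sxy x y).card

/-- `D(x,y;γ) = Ψ(x,y)⁻¹ ∑_{n ∈ S(x,y)} τ(n)⁻¹ #{d ∣ n : d ≥ √n e^γ}`. -/
def Dxy (x y γ : ℝ) : ℝ :=
  (Psi x y : ℝ)⁻¹ * ∑ n ∈ Sxy x y,
    ((n.divisors.card : ℝ))⁻¹ *
      ((n.divisors.filter (fun d => Real.sqrt n * Real.exp γ ≤ (d : ℝ))).card : ℝ)

/-- `Φ(v) = ∫_v^∞ e^{-z²/2} dz/√(2π)`. -/
def PhiGauss (v : ℝ) : ℝ :=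
  ∫ z in Set.Ioi v, Real.exp (-z ^ 2 / 2) / Real.sqrt (2 * Real.pi)

/-- `g(z) = log((z^{1/2} − z^{-1/2})/log z)`, with `g(1) = 0`. -/
def gfun (z : ℂ) : ℂ :=
  if z = 1 then 0
  else Complex.log ((z ^ (2⁻¹ : ℂ) - z ^ (-2⁻¹ : ℂ)) / Complex.log z)

/-- `Ξ(a,b) = −(1/2)log(1−a) − (1/2)log(1−b) − g((1−a)/(1−b))`. -/
def Xi (a b : ℂ) : ℂ :=
  -(2⁻¹ : ℂ) * Complex.log (1 - a) - (2⁻¹ : ℂ) * Complex.log (1 - b) -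
    gfun ((1 - a) / (1 - b))

/-- `f_y(s,w) = ∑_{p ≤ y} Ξ(p^{-s}, p^{-w})`. -/
def fy (y : ℝ) (s w : ℂ) : ℂ := ∑ p ∈ primesLe y, Xi ((p : ℂ) ^ (-s)) ((p : ℂ) ^ (-w))

/-- `F_y(s,w) = exp(f_y(s,w))`. -/
def Fy (y : ℝ) (s w : ℂ) : ℂ := Complex.exp (fy y s w)

/-- `F_y(σ,κ)` at real arguments, as a (positive) real number. -/
def FyR (y σ κ : ℝ) : ℝ := Real.exp ((fy y (σ : ℂ) (κ : ℂ)).re)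

/-- `∂_{kℓ}f(s,w)`: partial derivative `k` times in the first variable and `ℓ` times
in the second. -/
def pdv (k l : ℕ) (f : ℂ → ℂ → ℂ) (s w : ℂ) : ℂ :=
  iteratedDeriv k (fun z => iteratedDeriv l (f z) w) s

/-- `Hess[f_y] = (∂₂₀f_y)(∂₀₂f_y) − (∂₁₁f_y)²`. -/
def HessC (y : ℝ) (s w : ℂ) : ℂ :=
  pdv 2 0 (fy y) s w * pdv 0 2 (fy y) s w - (pdv 1 1 (fy y) s w) ^ 2

/-- The domain `D_δ(α;y)`. -/
def Ddom (δ α y : ℝ) : Set (ℝ × ℝ) :=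
  {p | 0 < p.1 ∧ p.1 ≤ 1 ∧ 0 < p.2 ∧ p.2 ≤ 1 ∧ 0 ≤ (p.1 - α) * (α - p.2) ∧
    1 / (1 + δ) ≤ (1 - (2 : ℝ) ^ (-p.1)) / (1 - (2 : ℝ) ^ (-p.2)) ∧
    (1 - (2 : ℝ) ^ (-p.1)) / (1 - (2 : ℝ) ^ (-p.2)) ≤ 1 + δ ∧
    |p.1 - p.2| * Real.log y ≤ δ}

/-- `φ_k(s,y)`: the `k`-th derivative in `s` of `φ₀(s,y) = −∑_{p ≤ y} log(1−p^{-s})`. -/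
def phiD (y : ℝ) (k : ℕ) (s : ℂ) : ℂ :=
  iteratedDeriv k (fun z => -∑ p ∈ primesLe y, Complex.log (1 - (p : ℂ) ^ (-z))) s

/-- `φ₂(σ,y) = ∑_{p ≤ y} (log p)² p^σ/(p^σ−1)²` for real `σ`. -/
def phi2R (y σ : ℝ) : ℝ :=
  ∑ p ∈ primesLe y, (Real.log p) ^ 2 * (p : ℝ) ^ σ / ((p : ℝ) ^ σ - 1) ^ 2


/-- The exponential moment `∫_{-1/2}^{1/2} t^k e^{dt} dt`. -/
def expMoment (k : ℕ) (d : ℂ) : ℂ :=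
  ∫ t in (-(1 / 2) : ℝ)..(1 / 2), (t : ℂ) ^ k * Complex.exp (d * t)

/-- `expMoment` at a real argument, as a real number. -/
def expMomentR (k : ℕ) (d : ℝ) : ℝ :=
  ∫ t in (-(1 / 2) : ℝ)..(1 / 2), t ^ k * Real.exp (d * t)

lemma expMoment_ofReal (k : ℕ) (d : ℝ) : expMoment k (d : ℂ) = (expMomentR k d : ℂ) := by
  rw [expMoment, expMomentR, ← intervalIntegral.integral_ofReal]
  push_cast
  rfl

lemma hasDerivAt_expMoment (k : ℕ) (d : ℂ) :
    HasDerivAt (expMoment k) (expMoment (k + 1) d) d := by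
  refine (intervalIntegral.hasDerivAt_integral_of_dominated_loc_of_deriv_le
    (F := fun (x : ℂ) (t : ℝ) => (t : ℂ) ^ k * Complex.exp (x * t))
    (F' := fun (x : ℂ) (t : ℝ) => (t : ℂ) ^ (k + 1) * Complex.exp (x * t))
    (bound := fun _ => Real.exp (‖d‖ + 1))
    (Metric.ball_mem_nhds d one_pos) (.of_forall fun x => ?_) ?_ ?_ (.of_forall ?_) (by simp)
    (.of_forall ?_)).2
  · exact (by fun_prop :
      Continuous fun t : ℝ => (t : ℂ) ^ k * Complex.exp (x * t)).aestronglyMeasurable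
  · exact (by fun_prop :
      Continuous fun t : ℝ => (t : ℂ) ^ k * Complex.exp (d * t)).intervalIntegrable _ _
  · exact (by fun_prop :
      Continuous fun t : ℝ => (t : ℂ) ^ (k + 1) * Complex.exp (d * t)).aestronglyMeasurable
  · intro t ht x hx
    rw [Set.uIoc_of_le (by norm_num)] at ht
    have hnt : ‖(t : ℂ)‖ ≤ 1 := by
      rw [Complex.norm_real, Real.norm_eq_abs, abs_le]
      constructor <;> linarith [ht.1, ht.2]
    have hnx : ‖x‖ ≤ ‖d‖ + 1 := by
      have := norm_sub_norm_le x d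
      rw [Metric.mem_ball, dist_eq_norm] at hx
      linarith
    rw [norm_mul, norm_pow]
    calc ‖(t : ℂ)‖ ^ (k + 1) * ‖Complex.exp (x * t)‖ ≤ 1 * Real.exp ‖x * t‖ := by
          gcongr
          · exact pow_le_one₀ (norm_nonneg _) hnt
          · exact Complex.norm_exp_le_exp_norm _
      _ ≤ Real.exp (‖d‖ + 1) := by
          rw [one_mul, norm_mul]
          gcongr
          nlinarith [norm_nonneg x, norm_nonneg (t : ℂ)]
  · intro t _ x _
    have h := (((hasDerivAt_id x).mul_const (t : ℂ)).cexp).const_mul ((t : ℂ) ^ k)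
    exact h.congr_deriv (by simp only [id]; ring)

lemma expMoment_zero_re_pos {d : ℂ} (hd : |d.im| < π) : 0 < (expMoment 0 d).re := by
  have hc : Continuous fun t : ℝ => (t : ℂ) ^ 0 * Complex.exp (d * t) := by fun_prop
  have h := Complex.reCLM.intervalIntegral_comp_comm
    (hc.intervalIntegrable (μ := volume) (-(1 / 2)) (1 / 2))
  simp only [Complex.reCLM_apply] at h
  rw [expMoment, ← h]
  refine intervalIntegral.intervalIntegral_pos_of_pos_on
    ((Complex.continuous_re.comp hc).intervalIntegrable _ _) (fun t ht => ?_) (by norm_num)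
  have ht' : |t| < 1 / 2 := abs_lt.2 ht
  have hlt : |d.im * t| < π / 2 := by
    rw [abs_mul]
    nlinarith [abs_nonneg t, abs_nonneg d.im, Real.pi_pos]
  simp only [pow_zero, one_mul, Complex.exp_re]
  have him : (d * t).im = d.im * t := by simp
  rw [him]
  exact mul_pos (Real.exp_pos _) (Real.cos_pos_of_mem_Ioo (abs_lt.1 hlt))

lemma mul_expMoment_zero (d : ℂ) :
    d * expMoment 0 d = Complex.exp (d / 2) - Complex.exp (-(d / 2)) := by
  have h := intervalIntegral.integral_eq_sub_of_hasDerivAt (a := -(1 / 2)) (b := 1 / 2)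
    (f := fun t : ℝ => Complex.exp (d * t)) (f' := fun t : ℝ => d * Complex.exp (d * t))
    (fun t _ => by
      have h := ((hasDerivAt_id (t : ℂ)).const_mul d).cexp.comp_ofReal
      exact h.congr_deriv (by simp only [id]; ring)) ((by fun_prop : Continuous _).intervalIntegrable _ _)
  rw [intervalIntegral.integral_const_mul] at h
  simp only [expMoment, pow_zero, one_mul]
  rw [h]
  congr 2 <;> push_cast <;> ring

lemma mul_expMomentR_succ (k : ℕ) (d : ℝ) :
    (k + 1) * expMomentR k d + d * expMomentR (k + 1) d =
      (1 / 2) ^ (k + 1) * Real.exp (d / 2) - (-(1 / 2)) ^ (k + 1) * Real.exp (-(d / 2)) := by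
  have h := intervalIntegral.integral_eq_sub_of_hasDerivAt (a := -(1 / 2)) (b := 1 / 2)
    (f := fun t : ℝ => t ^ (k + 1) * Real.exp (d * t))
    (f' := fun t : ℝ => (k + 1) * (t ^ k * Real.exp (d * t)) +
      d * (t ^ (k + 1) * Real.exp (d * t)))
    (fun t _ => by
      have h := (hasDerivAt_pow (k + 1) t).mul ((hasDerivAt_id t).const_mul d).exp
      exact h.congr_deriv (by simp only [id, Nat.add_sub_cancel]; push_cast; ring)) ((by fun_prop : Continuous _).intervalIntegrable _ _)
  rw [intervalIntegral.integral_add ((by fun_prop : Continuous _).intervalIntegrable _ _)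
    ((by fun_prop : Continuous _).intervalIntegrable _ _), intervalIntegral.integral_const_mul,
    intervalIntegral.integral_const_mul] at h
  rw [expMomentR, expMomentR, h]
  congr 3 <;> ring

lemma mul_expMomentR_zero (d : ℝ) :
    d * expMomentR 0 d = Real.exp (d / 2) - Real.exp (-(d / 2)) := by
  have h := mul_expMoment_zero (d : ℂ)
  rw [expMoment_ofReal] at h
  exact_mod_cast h

/-- A quadratic that is nonnegative and not identically zero on `[-1/2, 1/2]` has a positive
integral against `e^{dt}`. -/
lemma quadratic_expMomentR_pos (a b c d : ℝ)
    (hnn : ∀ t ∈ Set.Icc (-(1 / 2) : ℝ) (1 / 2), 0 ≤ a + b * t + c * t ^ 2)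
    (hpos : ∃ t ∈ Set.Icc (-(1 / 2) : ℝ) (1 / 2), 0 < a + b * t + c * t ^ 2) :
    0 < a * expMomentR 0 d + b * expMomentR 1 d + c * expMomentR 2 d := by
  have h : a * expMomentR 0 d + b * expMomentR 1 d + c * expMomentR 2 d =
      ∫ t in (-(1 / 2) : ℝ)..(1 / 2), (a + b * t + c * t ^ 2) * Real.exp (d * t) := by
    simp only [expMomentR]
    rw [← intervalIntegral.integral_const_mul, ← intervalIntegral.integral_const_mul,
      ← intervalIntegral.integral_const_mul, ← intervalIntegral.integral_add
        ((by fun_prop : Continuous _).intervalIntegrable _ _)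
        ((by fun_prop : Continuous _).intervalIntegrable _ _), ← intervalIntegral.integral_add
        ((by fun_prop : Continuous _).intervalIntegrable _ _)
        ((by fun_prop : Continuous _).intervalIntegrable _ _)]
    congr 1
    ext t
    ring
  rw [h]
  obtain ⟨t, ht, htp⟩ := hpos
  exact intervalIntegral.integral_pos (by norm_num) (by fun_prop)
    (fun t ht => mul_nonneg (hnn t ⟨ht.1.le, ht.2⟩) (Real.exp_pos _).le)
    ⟨t, ht, mul_pos htp (Real.exp_pos _)⟩

lemma expMomentR_zero_pos (d : ℝ) : 0 < expMomentR 0 d := by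
  have := quadratic_expMomentR_pos 1 0 0 d (fun t _ => by norm_num) ⟨0, by norm_num, by norm_num⟩
  linarith

/-- The logarithmic derivative of `expMomentR 0`: the mean of `t` for the weight `e^{dt}`. -/
def tiltedMean (d : ℝ) : ℝ := expMomentR 1 d / expMomentR 0 d

/-- The variance of `t` for the weight `e^{dt}` on `[-1/2, 1/2]`. -/
def tiltedVar (d : ℝ) : ℝ := expMomentR 2 d / expMomentR 0 d - tiltedMean d ^ 2

lemma tiltedMean_lt (d : ℝ) : tiltedMean d < 1 / 2 := by
  have h := quadratic_expMomentR_pos (1 / 2) (-1) 0 d (fun t ht => by linarith [ht.2])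
    ⟨0, by norm_num, by norm_num⟩
  rw [tiltedMean, div_lt_iff₀ (expMomentR_zero_pos d)]
  linarith

lemma lt_tiltedMean (d : ℝ) : -(1 / 2) < tiltedMean d := by
  have h := quadratic_expMomentR_pos (1 / 2) 1 0 d (fun t ht => by linarith [ht.1])
    ⟨0, by norm_num, by norm_num⟩
  rw [tiltedMean, lt_div_iff₀ (expMomentR_zero_pos d)]
  linarith

lemma tiltedVar_pos (d : ℝ) : 0 < tiltedVar d := by
  have h0 := expMomentR_zero_pos d
  set m := tiltedMean d with hm
  have h := quadratic_expMomentR_pos (m ^ 2) (-2 * m) 1 d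
    (fun t _ => by nlinarith [sq_nonneg (t - m)])
    (by
      by_cases hz : m = 0
      · exact ⟨1 / 2, by norm_num, by rw [hz]; norm_num⟩
      · exact ⟨0, by norm_num, by
          have := pow_pos (abs_pos.2 hz) 2
          rw [sq_abs] at this
          linarith⟩)
  have h1 : expMomentR 1 d = m * expMomentR 0 d := by rw [hm, tiltedMean]; field_simp
  rw [tiltedVar, sub_pos, lt_div_iff₀ h0]
  rw [h1] at h
  linarith

lemma tiltedVar_lt (d : ℝ) : tiltedVar d < (1 / 2 + tiltedMean d) * (1 / 2 - tiltedMean d) := by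
  have h := quadratic_expMomentR_pos (1 / 4) 0 (-1) d
    (fun t ht => by nlinarith [ht.1, ht.2]) ⟨0, by norm_num, by norm_num⟩
  have h2 : expMomentR 2 d / expMomentR 0 d < 1 / 4 := by
    rw [div_lt_iff₀ (expMomentR_zero_pos d)]
    linarith
  rw [tiltedVar]
  linarith

lemma tiltedMean_add_tiltedVar_pos (d : ℝ) :
    0 < 1 / 2 + tiltedMean d + tiltedVar d * (Real.exp d - 1) := by
  have h0 := expMomentR_zero_pos d
  have hlt := tiltedMean_lt d
  have e0 := mul_expMomentR_zero d
  have e1 := mul_expMomentR_succ 0 d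
  have e2 := mul_expMomentR_succ 1 d
  have hexp : Real.exp d = Real.exp (d / 2) ^ 2 := by rw [← Real.exp_nat_mul]; congr 1; ring
  have hinv : Real.exp (d / 2) * Real.exp (-(d / 2)) = 1 := by rw [← Real.exp_add]; simp
  have h1 : expMomentR 1 d = tiltedMean d * expMomentR 0 d := by rw [tiltedMean]; field_simp
  have h2 : expMomentR 2 d = (tiltedVar d + tiltedMean d ^ 2) * expMomentR 0 d := by
    rw [tiltedVar]; field_simp; ring
  set h := Real.exp (d / 2) with hh
  set k := Real.exp (-(d / 2)) with hk
  have hpos : 0 < h := Real.exp_pos _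
  set N := expMomentR 0 d
  set m := tiltedMean d
  set v := tiltedVar d
  norm_num at e1 e2
  rw [h1] at e1 e2
  rw [h2] at e2
  rw [hexp]
  suffices 1 / 2 + m + v * (h ^ 2 - 1) = h * (N * (1 / 2 - m)) by
    rw [this]
    have : 0 < 1 / 2 - m := by linarith
    positivity
  have hmean : m * (h ^ 2 - 1) = (h ^ 2 + 1) / 2 - h * N := by
    linear_combination h * e1 - m * h * e0 + (m + 1 / 2) * hinv
  have hvar : 2 * m * N * h + (v + m ^ 2) * (h ^ 2 - 1) = (h ^ 2 - 1) / 4 := by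
    linear_combination h * e2 - (v + m ^ 2) * h * e0 + (v + m ^ 2 - 1 / 4) * hinv
  linear_combination hvar - m * hmean - hmean / 2

/-- The logarithm of the Euler factor `1 - p^{-s}`. -/
def logEuler (p : ℕ) (s : ℂ) : ℂ := Complex.log (1 - (p : ℂ) ^ (-s))

/-- The ratio `p^{-s}/(1 - p^{-s})`. -/
def eulerRatio (p : ℕ) (s : ℂ) : ℂ := (p : ℂ) ^ (-s) / (1 - (p : ℂ) ^ (-s))

lemma one_sub_cpow_neg_re_pos {p : ℕ} (hp : 1 < p) {s : ℂ} (hs : 0 < s.re) :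
    0 < (1 - (p : ℂ) ^ (-s)).re := by
  have h : ‖(p : ℂ) ^ (-s)‖ < 1 := by
    rw [Complex.norm_natCast_cpow_of_pos (by lia)]
    exact Real.rpow_lt_one_of_one_lt_of_neg (by exact_mod_cast hp) (by simpa using hs)
  have := Complex.re_le_norm ((p : ℂ) ^ (-s))
  rw [Complex.sub_re, Complex.one_re]
  linarith

lemma one_sub_cpow_neg_ne_zero {p : ℕ} (hp : 1 < p) {s : ℂ} (hs : 0 < s.re) :
    1 - (p : ℂ) ^ (-s) ≠ 0 := by
  intro h
  have := one_sub_cpow_neg_re_pos hp hs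
  simp [h] at this

lemma hasDerivAt_one_sub_cpow_neg {p : ℕ} (hp : 1 < p) (s : ℂ) :
    HasDerivAt (fun z : ℂ => 1 - (p : ℂ) ^ (-z)) (Complex.log p * (p : ℂ) ^ (-s)) s := by
  have hp0 : (p : ℂ) ≠ 0 := by exact_mod_cast (by lia : p ≠ 0)
  exact (((hasDerivAt_neg s).const_cpow (Or.inl hp0)).const_sub 1).congr_deriv (by ring)

lemma hasDerivAt_logEuler {p : ℕ} (hp : 1 < p) {s : ℂ} (hs : 0 < s.re) :
    HasDerivAt (logEuler p) (Complex.log p * eulerRatio p s) s :=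
  ((hasDerivAt_one_sub_cpow_neg hp s).clog
    (Or.inl (one_sub_cpow_neg_re_pos hp hs))).congr_deriv (by rw [eulerRatio]; ring)

lemma hasDerivAt_eulerRatio {p : ℕ} (hp : 1 < p) {s : ℂ} (hs : 0 < s.re) :
    HasDerivAt (eulerRatio p)
      (-(Complex.log p * (eulerRatio p s * (1 + eulerRatio p s)))) s := by
  have h0 := one_sub_cpow_neg_ne_zero hp hs
  have h1 := hasDerivAt_one_sub_cpow_neg hp s
  have h2 : HasDerivAt (fun z : ℂ => (p : ℂ) ^ (-z)) (-(Complex.log p * (p : ℂ) ^ (-s))) s := by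
    simpa using h1.const_sub 1
  exact (h2.div h1 h0).congr_deriv (by rw [eulerRatio]; field_simp; ring)

lemma abs_logEuler_sub_im_lt {p : ℕ} (hp : 1 < p) {s w : ℂ} (hs : 0 < s.re) (hw : 0 < w.re) :
    |(logEuler p s - logEuler p w).im| < π := by
  have h : ∀ {z : ℂ}, 0 < z.re → |(logEuler p z).im| < π / 2 := fun hz => by
    rw [logEuler, Complex.log_im]
    exact Complex.abs_arg_lt_pi_div_two_iff.2 (Or.inl (one_sub_cpow_neg_re_pos hp hz))
  have h1 := abs_lt.1 (h hs)
  have h2 := abs_lt.1 (h hw)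
  rw [Complex.sub_im, abs_lt]
  constructor <;> linarith

lemma gfun_exp {d : ℂ} (hd : |d.im| < π) :
    gfun (Complex.exp d) = Complex.log (expMoment 0 d) := by
  have hlog : Complex.log (Complex.exp d) = d :=
    Complex.log_exp (abs_lt.1 hd).1 (abs_lt.1 hd).2.le
  have hm := mul_expMoment_zero d
  rw [gfun]
  split_ifs with h
  · have hd0 : d = 0 := by rw [← hlog, h, Complex.log_one]
    subst hd0
    norm_num [expMoment]
  · have hd0 : d ≠ 0 := by rintro rfl; simp at h
    rw [Complex.cpow_def_of_ne_zero (Complex.exp_ne_zero d),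
      Complex.cpow_def_of_ne_zero (Complex.exp_ne_zero d), hlog]
    congr 1
    rw [div_eq_iff hd0, mul_comm (expMoment 0 d), hm]
    congr 2
    ring

lemma Xi_cpow_neg {p : ℕ} (hp : 1 < p) {s w : ℂ} (hs : 0 < s.re) (hw : 0 < w.re) :
    Xi ((p : ℂ) ^ (-s)) ((p : ℂ) ^ (-w)) = -(2⁻¹ : ℂ) * logEuler p s - 2⁻¹ * logEuler p w -
      Complex.log (expMoment 0 (logEuler p s - logEuler p w)) := by
  rw [← gfun_exp (abs_logEuler_sub_im_lt hp hs hw), Complex.exp_sub, logEuler, logEuler,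
    Complex.exp_log (one_sub_cpow_neg_ne_zero hp hs),
    Complex.exp_log (one_sub_cpow_neg_ne_zero hp hw), Xi]

/-- The logarithmic derivative of `expMoment 0`. -/
def tiltedMeanC (d : ℂ) : ℂ := expMoment 1 d / expMoment 0 d

/-- The derivative of `tiltedMeanC`. -/
def tiltedVarC (d : ℂ) : ℂ := expMoment 2 d / expMoment 0 d - tiltedMeanC d ^ 2

lemma hasDerivAt_log_expMoment {d : ℂ} (hd : |d.im| < π) :
    HasDerivAt (fun z => Complex.log (expMoment 0 z)) (tiltedMeanC d) d :=
  (hasDerivAt_expMoment 0 d).clog (Or.inl (expMoment_zero_re_pos hd))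

lemma hasDerivAt_tiltedMeanC {d : ℂ} (hd : |d.im| < π) :
    HasDerivAt tiltedMeanC (tiltedVarC d) d := by
  have h0 : expMoment 0 d ≠ 0 := by
    intro h
    have := expMoment_zero_re_pos hd
    simp [h] at this
  exact ((hasDerivAt_expMoment 1 d).div (hasDerivAt_expMoment 0 d) h0).congr_deriv (by
    rw [tiltedVarC, tiltedMeanC]; field_simp)

/-- The contribution of `p` to `∂₁₀f_y`. -/
def XiFst (p : ℕ) (s w : ℂ) : ℂ :=
  -(Complex.log p * eulerRatio p s * (2⁻¹ + tiltedMeanC (logEuler p s - logEuler p w)))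

/-- The contribution of `p` to `∂₀₁f_y`. -/
def XiSnd (p : ℕ) (s w : ℂ) : ℂ :=
  -(Complex.log p * eulerRatio p w * (2⁻¹ - tiltedMeanC (logEuler p s - logEuler p w)))

section Derivatives

variable {p : ℕ} {s w : ℂ}

lemma eventually_re_pos (hs : 0 < s.re) : ∀ᶠ z in nhds s, 0 < z.re :=
  Complex.continuous_re.continuousAt.eventually (lt_mem_nhds hs)

lemma hasDerivAt_Xi_fst (hp : 1 < p) (hs : 0 < s.re) (hw : 0 < w.re) :
    HasDerivAt (fun z => Xi ((p : ℂ) ^ (-z)) ((p : ℂ) ^ (-w))) (XiFst p s w) s := by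
  have hX := hasDerivAt_logEuler hp hs
  have h := ((hX.const_mul (-(2⁻¹ : ℂ))).sub_const (2⁻¹ * logEuler p w)).sub
    ((hasDerivAt_log_expMoment (abs_logEuler_sub_im_lt hp hs hw)).comp s
      (hX.sub_const (logEuler p w)))
  refine (h.congr_of_eventuallyEq ?_).congr_deriv (by rw [XiFst]; ring)
  filter_upwards [eventually_re_pos hs] with z hz using Xi_cpow_neg hp hz hw

lemma hasDerivAt_Xi_snd (hp : 1 < p) (hs : 0 < s.re) (hw : 0 < w.re) :
    HasDerivAt (fun z => Xi ((p : ℂ) ^ (-s)) ((p : ℂ) ^ (-z))) (XiSnd p s w) w := by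
  have hX := hasDerivAt_logEuler hp hw
  have h := ((hX.const_mul (2⁻¹ : ℂ)).const_sub (-(2⁻¹ : ℂ) * logEuler p s)).sub
    ((hasDerivAt_log_expMoment (abs_logEuler_sub_im_lt hp hs hw)).comp w
      (hX.const_sub (logEuler p s)))
  refine (h.congr_of_eventuallyEq ?_).congr_deriv (by rw [XiSnd]; ring)
  filter_upwards [eventually_re_pos hw] with z hz using Xi_cpow_neg hp hs hz

lemma hasDerivAt_XiFst_fst (hp : 1 < p) (hs : 0 < s.re) (hw : 0 < w.re) :
    HasDerivAt (fun z => XiFst p z w)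
      (Complex.log p ^ 2 * (eulerRatio p s * (1 + eulerRatio p s) *
          (2⁻¹ + tiltedMeanC (logEuler p s - logEuler p w)) -
        tiltedVarC (logEuler p s - logEuler p w) * eulerRatio p s ^ 2)) s := by
  have hm := (hasDerivAt_tiltedMeanC (abs_logEuler_sub_im_lt hp hs hw)).comp s
    ((hasDerivAt_logEuler hp hs).sub_const (logEuler p w))
  exact ((((hasDerivAt_eulerRatio hp hs).const_mul (Complex.log p)).mul
    (hm.const_add 2⁻¹)).neg).congr_deriv (by simp only [Function.comp]; ring)

lemma hasDerivAt_XiSnd_fst (hp : 1 < p) (hs : 0 < s.re) (hw : 0 < w.re) :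
    HasDerivAt (fun z => XiSnd p z w)
      (Complex.log p ^ 2 * (tiltedVarC (logEuler p s - logEuler p w) *
        eulerRatio p s * eulerRatio p w)) s := by
  have hm := (hasDerivAt_tiltedMeanC (abs_logEuler_sub_im_lt hp hs hw)).comp s
    ((hasDerivAt_logEuler hp hs).sub_const (logEuler p w))
  exact ((hm.const_sub 2⁻¹).const_mul (Complex.log p * eulerRatio p w)).neg.congr_deriv (by ring)

lemma hasDerivAt_XiSnd_snd (hp : 1 < p) (hs : 0 < s.re) (hw : 0 < w.re) :
    HasDerivAt (XiSnd p s)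
      (Complex.log p ^ 2 * (eulerRatio p w * (1 + eulerRatio p w) *
          (2⁻¹ - tiltedMeanC (logEuler p s - logEuler p w)) -
        tiltedVarC (logEuler p s - logEuler p w) * eulerRatio p w ^ 2)) w := by
  have hm := (hasDerivAt_tiltedMeanC (abs_logEuler_sub_im_lt hp hs hw)).comp w
    ((hasDerivAt_logEuler hp hw).const_sub (logEuler p s))
  exact ((((hasDerivAt_eulerRatio hp hw).const_mul (Complex.log p)).mul
    (hm.const_sub 2⁻¹)).neg).congr_deriv (by simp only [Function.comp]; ring)

end Derivatives

lemma one_lt_of_mem_primesLe {y : ℝ} {p : ℕ} (hp : p ∈ primesLe y) : 1 < p :=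
  (Finset.mem_filter.1 hp).2.one_lt

lemma pdv_two_zero_fy (y : ℝ) {s w : ℂ} (hs : 0 < s.re) (hw : 0 < w.re) :
    pdv 2 0 (fy y) s w = ∑ p ∈ primesLe y,
      Complex.log p ^ 2 * (eulerRatio p s * (1 + eulerRatio p s) *
          (2⁻¹ + tiltedMeanC (logEuler p s - logEuler p w)) -
        tiltedVarC (logEuler p s - logEuler p w) * eulerRatio p s ^ 2) := by
  simp only [pdv, iteratedDeriv_zero]
  rw [iteratedDeriv_succ, iteratedDeriv_one]
  have h : deriv (fun z => fy y z w) =ᶠ[nhds s] fun z => ∑ p ∈ primesLe y, XiFst p z w := by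
    filter_upwards [eventually_re_pos hs] with z hz
    exact (HasDerivAt.fun_sum fun p hp =>
      hasDerivAt_Xi_fst (one_lt_of_mem_primesLe hp) hz hw).deriv
  rw [h.deriv_eq]
  exact (HasDerivAt.fun_sum fun p hp =>
    hasDerivAt_XiFst_fst (one_lt_of_mem_primesLe hp) hs hw).deriv

lemma deriv_fy_snd (y : ℝ) {s w : ℂ} (hs : 0 < s.re) (hw : 0 < w.re) :
    deriv (fy y s) w = ∑ p ∈ primesLe y, XiSnd p s w :=
  (HasDerivAt.fun_sum fun _ hp =>
    hasDerivAt_Xi_snd (one_lt_of_mem_primesLe hp) hs hw).deriv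

lemma pdv_one_one_fy (y : ℝ) {s w : ℂ} (hs : 0 < s.re) (hw : 0 < w.re) :
    pdv 1 1 (fy y) s w = ∑ p ∈ primesLe y,
      Complex.log p ^ 2 * (tiltedVarC (logEuler p s - logEuler p w) *
        eulerRatio p s * eulerRatio p w) := by
  simp only [pdv, iteratedDeriv_one]
  have h : (fun z => deriv (fy y z) w) =ᶠ[nhds s] fun z => ∑ p ∈ primesLe y, XiSnd p z w := by
    filter_upwards [eventually_re_pos hs] with z hz using deriv_fy_snd y hz hw
  rw [h.deriv_eq]
  exact (HasDerivAt.fun_sum fun p hp =>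
    hasDerivAt_XiSnd_fst (one_lt_of_mem_primesLe hp) hs hw).deriv

lemma pdv_zero_two_fy (y : ℝ) {s w : ℂ} (hs : 0 < s.re) (hw : 0 < w.re) :
    pdv 0 2 (fy y) s w = ∑ p ∈ primesLe y,
      Complex.log p ^ 2 * (eulerRatio p w * (1 + eulerRatio p w) *
          (2⁻¹ - tiltedMeanC (logEuler p s - logEuler p w)) -
        tiltedVarC (logEuler p s - logEuler p w) * eulerRatio p w ^ 2) := by
  simp only [pdv, iteratedDeriv_zero]
  rw [iteratedDeriv_succ, iteratedDeriv_one]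
  have h : deriv (fy y s) =ᶠ[nhds w] fun z => ∑ p ∈ primesLe y, XiSnd p s z := by
    filter_upwards [eventually_re_pos hw] with z hz using deriv_fy_snd y hs hz
  rw [h.deriv_eq]
  exact (HasDerivAt.fun_sum fun p hp =>
    hasDerivAt_XiSnd_snd (one_lt_of_mem_primesLe hp) hs hw).deriv

/-- `eulerRatio` at a real argument, as a real number. -/
def eulerRatioR (p : ℕ) (σ : ℝ) : ℝ := (p : ℝ) ^ (-σ) / (1 - (p : ℝ) ^ (-σ))

/-- `logEuler p σ - logEuler p κ` at real arguments, as a real number. -/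
def logEulerDiff (p : ℕ) (σ κ : ℝ) : ℝ :=
  Real.log (1 - (p : ℝ) ^ (-σ)) - Real.log (1 - (p : ℝ) ^ (-κ))

lemma natCast_cpow_neg_ofReal (p : ℕ) (σ : ℝ) :
    (p : ℂ) ^ (-(σ : ℂ)) = (((p : ℝ) ^ (-σ) : ℝ) : ℂ) := by
  rw [Complex.ofReal_cpow (Nat.cast_nonneg p)]
  push_cast
  rfl

lemma eulerRatio_ofReal (p : ℕ) (σ : ℝ) : eulerRatio p (σ : ℂ) = (eulerRatioR p σ : ℂ) := by
  rw [eulerRatio, eulerRatioR, natCast_cpow_neg_ofReal]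
  push_cast
  rfl

lemma rpow_neg_mem_Ioo {p : ℕ} (hp : 1 < p) {σ : ℝ} (hσ : 0 < σ) :
    (p : ℝ) ^ (-σ) ∈ Set.Ioo (0 : ℝ) 1 :=
  ⟨Real.rpow_pos_of_pos (by exact_mod_cast (by lia : 0 < p)) _,
    Real.rpow_lt_one_of_one_lt_of_neg (by exact_mod_cast hp) (by simpa using hσ)⟩

lemma logEuler_sub_ofReal {p : ℕ} (hp : 1 < p) {σ κ : ℝ} (hσ : 0 < σ) (hκ : 0 < κ) :
    logEuler p (σ : ℂ) - logEuler p (κ : ℂ) = (logEulerDiff p σ κ : ℂ) := by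
  have h1 := (rpow_neg_mem_Ioo hp hσ).2
  have h2 := (rpow_neg_mem_Ioo hp hκ).2
  rw [logEuler, logEuler, logEulerDiff, natCast_cpow_neg_ofReal, natCast_cpow_neg_ofReal,
    Complex.ofReal_sub, Complex.ofReal_log (by linarith), Complex.ofReal_log (by linarith)]
  push_cast
  rfl

lemma tiltedMeanC_ofReal (d : ℝ) : tiltedMeanC (d : ℂ) = (tiltedMean d : ℂ) := by
  simp [tiltedMeanC, tiltedMean, expMoment_ofReal]

lemma tiltedVarC_ofReal (d : ℝ) : tiltedVarC (d : ℂ) = (tiltedVar d : ℂ) := by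
  simp [tiltedVarC, tiltedVar, expMoment_ofReal, tiltedMeanC_ofReal]

lemma eulerRatioR_pos {p : ℕ} (hp : 1 < p) {σ : ℝ} (hσ : 0 < σ) : 0 < eulerRatioR p σ := by
  obtain ⟨h0, h1⟩ := rpow_neg_mem_Ioo hp hσ
  exact div_pos h0 (by linarith)

lemma one_add_eulerRatioR {p : ℕ} (hp : 1 < p) {σ κ : ℝ} (hσ : 0 < σ) (hκ : 0 < κ) :
    1 + eulerRatioR p κ = Real.exp (logEulerDiff p σ κ) * (1 + eulerRatioR p σ) := by
  have h1 : 0 < 1 - (p : ℝ) ^ (-σ) := by linarith [(rpow_neg_mem_Ioo hp hσ).2]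
  have h2 : 0 < 1 - (p : ℝ) ^ (-κ) := by linarith [(rpow_neg_mem_Ioo hp hκ).2]
  rw [logEulerDiff, Real.exp_sub, Real.exp_log h1, Real.exp_log h2, eulerRatioR, eulerRatioR]
  field_simp
  ring

/-- The contribution of `p` to `∂₂₀f_y` at real arguments. -/
def XiFstFst (p : ℕ) (σ κ : ℝ) : ℝ :=
  Real.log p ^ 2 * (eulerRatioR p σ * (1 + eulerRatioR p σ) *
    (2⁻¹ + tiltedMean (logEulerDiff p σ κ)) -
      tiltedVar (logEulerDiff p σ κ) * eulerRatioR p σ ^ 2)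

/-- The contribution of `p` to `∂₁₁f_y` at real arguments. -/
def XiFstSnd (p : ℕ) (σ κ : ℝ) : ℝ :=
  Real.log p ^ 2 * (tiltedVar (logEulerDiff p σ κ) * eulerRatioR p σ * eulerRatioR p κ)

/-- The contribution of `p` to `∂₀₂f_y` at real arguments. -/
def XiSndSnd (p : ℕ) (σ κ : ℝ) : ℝ :=
  Real.log p ^ 2 * (eulerRatioR p κ * (1 + eulerRatioR p κ) *
    (2⁻¹ - tiltedMean (logEulerDiff p σ κ)) -
      tiltedVar (logEulerDiff p σ κ) * eulerRatioR p κ ^ 2)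

lemma pdv_two_zero_fy_ofReal (y : ℝ) {σ κ : ℝ} (hσ : 0 < σ) (hκ : 0 < κ) :
    pdv 2 0 (fy y) (σ : ℂ) (κ : ℂ) = ((∑ p ∈ primesLe y, XiFstFst p σ κ : ℝ) : ℂ) := by
  rw [pdv_two_zero_fy y (by simpa) (by simpa), Complex.ofReal_sum]
  refine Finset.sum_congr rfl fun p hp => ?_
  rw [logEuler_sub_ofReal (one_lt_of_mem_primesLe hp) hσ hκ, eulerRatio_ofReal,
    tiltedMeanC_ofReal, tiltedVarC_ofReal, XiFstFst, ← Complex.natCast_log]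
  push_cast
  rfl

lemma pdv_one_one_fy_ofReal (y : ℝ) {σ κ : ℝ} (hσ : 0 < σ) (hκ : 0 < κ) :
    pdv 1 1 (fy y) (σ : ℂ) (κ : ℂ) = ((∑ p ∈ primesLe y, XiFstSnd p σ κ : ℝ) : ℂ) := by
  rw [pdv_one_one_fy y (by simpa) (by simpa), Complex.ofReal_sum]
  refine Finset.sum_congr rfl fun p hp => ?_
  rw [logEuler_sub_ofReal (one_lt_of_mem_primesLe hp) hσ hκ, eulerRatio_ofReal,
    eulerRatio_ofReal, tiltedVarC_ofReal, XiFstSnd, ← Complex.natCast_log]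
  push_cast
  rfl

lemma pdv_zero_two_fy_ofReal (y : ℝ) {σ κ : ℝ} (hσ : 0 < σ) (hκ : 0 < κ) :
    pdv 0 2 (fy y) (σ : ℂ) (κ : ℂ) = ((∑ p ∈ primesLe y, XiSndSnd p σ κ : ℝ) : ℂ) := by
  rw [pdv_zero_two_fy y (by simpa) (by simpa), Complex.ofReal_sum]
  refine Finset.sum_congr rfl fun p hp => ?_
  rw [logEuler_sub_ofReal (one_lt_of_mem_primesLe hp) hσ hκ, eulerRatio_ofReal,
    tiltedMeanC_ofReal, tiltedVarC_ofReal, XiSndSnd, ← Complex.natCast_log]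
  push_cast
  rfl

lemma XiFstFst_add_XiFstSnd_pos {p : ℕ} (hp : 1 < p) {σ κ : ℝ} (hσ : 0 < σ) (hκ : 0 < κ) :
    0 < XiFstFst p σ κ + XiFstSnd p σ κ := by
  have hL : 0 < Real.log p := Real.log_pos (by exact_mod_cast hp)
  have hP := eulerRatioR_pos hp hσ
  have hR := one_add_eulerRatioR hp hσ hκ
  have h := tiltedMean_add_tiltedVar_pos (logEulerDiff p σ κ)
  have heq : XiFstFst p σ κ + XiFstSnd p σ κ = Real.log p ^ 2 * eulerRatioR p σ *
      (1 + eulerRatioR p σ) * (1 / 2 + tiltedMean (logEulerDiff p σ κ) +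
        tiltedVar (logEulerDiff p σ κ) * (Real.exp (logEulerDiff p σ κ) - 1)) := by
    rw [XiFstFst, XiFstSnd]
    linear_combination
      Real.log p ^ 2 * tiltedVar (logEulerDiff p σ κ) * eulerRatioR p σ * hR
  rw [heq]
  positivity

lemma XiFstFst_pos {p : ℕ} (hp : 1 < p) {σ κ : ℝ} (hσ : 0 < σ) :
    0 < XiFstFst p σ κ := by
  have hL : 0 < Real.log p := Real.log_pos (by exact_mod_cast hp)
  have hP := eulerRatioR_pos hp hσ
  have hv := tiltedVar_pos (logEulerDiff p σ κ)
  have hlt := tiltedVar_lt (logEulerDiff p σ κ)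
  have hm := lt_tiltedMean (logEulerDiff p σ κ)
  rw [XiFstFst]
  set m := tiltedMean (logEulerDiff p σ κ)
  set v := tiltedVar (logEulerDiff p σ κ)
  set P := eulerRatioR p σ
  have hvm : 0 < 2⁻¹ + m - v := by nlinarith [sq_nonneg (1 / 2 + m)]
  have heq : P * (1 + P) * (2⁻¹ + m) - v * P ^ 2 = P * ((1 + P) * (2⁻¹ + m - v) + v) := by ring
  rw [heq]
  positivity

lemma sq_XiFstSnd_lt {p : ℕ} (hp : 1 < p) {σ κ : ℝ} (hσ : 0 < σ) (hκ : 0 < κ) :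
    XiFstSnd p σ κ ^ 2 < XiFstFst p σ κ * XiSndSnd p σ κ := by
  have hL : 0 < Real.log p := Real.log_pos (by exact_mod_cast hp)
  have hP := eulerRatioR_pos hp hσ
  have hQ := eulerRatioR_pos hp hκ
  have hv := tiltedVar_pos (logEulerDiff p σ κ)
  have hlt := tiltedVar_lt (logEulerDiff p σ κ)
  have hm := lt_tiltedMean (logEulerDiff p σ κ)
  have hm' := tiltedMean_lt (logEulerDiff p σ κ)
  rw [XiFstFst, XiFstSnd, XiSndSnd, ← sub_pos]
  set m := tiltedMean (logEulerDiff p σ κ)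
  set v := tiltedVar (logEulerDiff p σ κ)
  set P := eulerRatioR p σ
  set Q := eulerRatioR p κ
  have h1 : 0 < 1 / 2 + m := by linarith
  have h2 : 0 < 1 / 2 - m := by linarith
  have h3 : 0 < (1 / 2 + m) * (1 / 2 - m) - v := by linarith
  suffices 0 < Real.log p ^ 4 * (P * Q) * ((1 + P) * (1 + Q) * ((1 / 2 + m) * (1 / 2 - m) - v) +
      v * ((1 + P) * (1 / 2 + m) + (1 + Q) * (1 / 2 - m))) by
    convert this using 1
    ring
  positivity

/-- A nonempty sum of positive definite symmetric `2 × 2` matrices is positive definite. -/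
lemma sum_posDef {ι : Type*} {t : Finset ι} (ht : t.Nonempty) {a b c : ι → ℝ}
    (ha : ∀ i ∈ t, 0 < a i) (h : ∀ i ∈ t, b i ^ 2 < a i * c i) :
    (∑ i ∈ t, b i) ^ 2 < (∑ i ∈ t, a i) * ∑ i ∈ t, c i := by
  have hA : 0 < ∑ i ∈ t, a i := Finset.sum_pos ha ht
  have hc : ∀ i ∈ t, b i ^ 2 / a i < c i := fun i hi => by
    rw [div_lt_iff₀ (ha i hi), mul_comm]
    exact h i hi
  have h1 : (∑ i ∈ t, b i) ^ 2 / ∑ i ∈ t, a i ≤ ∑ i ∈ t, b i ^ 2 / a i :=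
    Finset.sq_sum_div_le_sum_sq_div t b ha
  have h2 := h1.trans_lt (Finset.sum_lt_sum_of_nonempty ht hc)
  rwa [div_lt_iff₀ hA, mul_comm] at h2

lemma primesLe_nonempty {y : ℝ} (hy : 2 ≤ y) : (primesLe y).Nonempty :=
  ⟨2, Finset.mem_filter.2 ⟨Finset.mem_Iic.2 (Nat.le_floor (by exact_mod_cast hy)),
    Nat.prime_two⟩⟩

/-- Lemma 4.(ii): `∂₂₀f_y + ∂₁₁f_y > 0` and `Hess[f_y] > 0` at
positive real arguments, where the values in question are real. -/
theorem stmt10 :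
    ∀ y : ℝ, 2 ≤ y → ∀ σ κ : ℝ, 0 < σ → 0 < κ →
      (pdv 2 0 (fy y) (σ : ℂ) (κ : ℂ) + pdv 1 1 (fy y) (σ : ℂ) (κ : ℂ)).im = 0 ∧
      0 < (pdv 2 0 (fy y) (σ : ℂ) (κ : ℂ)).re + (pdv 1 1 (fy y) (σ : ℂ) (κ : ℂ)).re ∧
      (HessC y (σ : ℂ) (κ : ℂ)).im = 0 ∧
      0 < (HessC y (σ : ℂ) (κ : ℂ)).re := by
  intro y hy σ κ hσ hκ
  have hne := primesLe_nonempty hy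
  rw [HessC, pdv_two_zero_fy_ofReal y hσ hκ, pdv_one_one_fy_ofReal y hσ hκ,
    pdv_zero_two_fy_ofReal y hσ hκ, ← Complex.ofReal_add, ← Complex.ofReal_mul,
    ← Complex.ofReal_pow, ← Complex.ofReal_sub]
  simp only [Complex.ofReal_im, Complex.ofReal_re, true_and]
  constructor
  · rw [← Finset.sum_add_distrib]
    exact Finset.sum_pos
      (fun p hp => XiFstFst_add_XiFstSnd_pos (one_lt_of_mem_primesLe hp) hσ hκ) hne
  · exact sub_pos.2 (sum_posDef hne
      (fun p hp => XiFstFst_pos (one_lt_of_mem_primesLe hp) hσ)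
      (fun p hp => sq_XiFstSnd_lt (one_lt_of_mem_primesLe hp) hσ hκ))

end
end

section
/- For every ε > 0 there exists a constant c₂ = c₂(ε) > 0 such that for all y ≥ 2 and all s = σ+iτ, w = κ+it with min{σ,κ} ≥ ε/log y, max{σ,κ} ≤ 0.6, and max{|τ|,|t|} ≤ c₂/log y, one has Re(f_y(s,w) − f_y(σ,κ)) ≤ −c₂ ( τ² φ₂(σ,y) + t² φ₂(κ,y) ), where φ₂(σ,y) := ∑_{p ≤ y, p prime} (log p)² p^σ/(p^σ − 1)². -/
open Complex Finset MeasureTheory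
open scoped Real Classical

noncomputable section

/-- The degree-`n` homogeneous part of the power series of `exp (Ξ(a,b))`. -/
def expXiTerm (n : ℕ) (a b : ℂ) : ℂ :=
  (∑ i ∈ range (n + 1), a ^ i * b ^ (n - i)) / (n + 1)

lemma log_div_of_re_pos {A B : ℂ} (hA : 0 < A.re) (hB : 0 < B.re) :
    Complex.log (A / B) = Complex.log A - Complex.log B := by
  have hA0 : A ≠ 0 := by rintro rfl; simp at hA
  have hB0 : B ≠ 0 := by rintro rfl; simp at hB
  have h1 := abs_lt.1 (Complex.abs_arg_lt_pi_div_two_iff.2 (Or.inl hA))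
  have h2 := abs_lt.1 (Complex.abs_arg_lt_pi_div_two_iff.2 (Or.inl hB))
  have hexp : A / B = Complex.exp (Complex.log A - Complex.log B) := by
    rw [Complex.exp_sub, Complex.exp_log hA0, Complex.exp_log hB0]
  rw [hexp, Complex.log_exp] <;> simp only [Complex.sub_im, Complex.log_im] <;> linarith [h1.1]

lemma one_sub_re_pos {a : ℂ} (ha : ‖a‖ < 1) : 0 < (1 - a).re := by
  have := Complex.re_le_norm a
  simp only [Complex.sub_re, Complex.one_re]
  linarith

lemma exp_Xi_mul_sub {a b : ℂ} (ha : ‖a‖ < 1) (hb : ‖b‖ < 1) (hab : a ≠ b) :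
    Complex.exp (Xi a b) * (a - b) = Complex.log (1 - b) - Complex.log (1 - a) := by
  have hA := one_sub_re_pos ha
  have hB := one_sub_re_pos hb
  have hA0 : 1 - a ≠ 0 := fun h => by simp [h] at hA
  have hB0 : 1 - b ≠ 0 := fun h => by simp [h] at hB
  have hz0 : (1 - a) / (1 - b) ≠ 0 := div_ne_zero hA0 hB0
  have hz1 : (1 - a) / (1 - b) ≠ 1 := by
    rw [Ne, div_eq_one_iff_eq hB0]
    exact fun h => hab (by linear_combination -h)
  have hlog := log_div_of_re_pos hA hB
  have eA := Complex.exp_log hA0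
  have eB := Complex.exp_log hB0
  set LA := Complex.log (1 - a)
  set LB := Complex.log (1 - b)
  have hL : LA - LB ≠ 0 := by
    intro h
    apply hab
    have : LA = LB := by linear_combination h
    rw [this, eB] at eA
    linear_combination eA
  have hnum : ((1 - a) / (1 - b)) ^ (2⁻¹ : ℂ) - ((1 - a) / (1 - b)) ^ (-2⁻¹ : ℂ)
      = Complex.exp (-2⁻¹ * LA - 2⁻¹ * LB) * (b - a) := by
    rw [Complex.cpow_def_of_ne_zero hz0, Complex.cpow_def_of_ne_zero hz0, hlog,
      show b - a = Complex.exp LA - Complex.exp LB by rw [eA, eB]; ring, mul_sub,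
      ← Complex.exp_add, ← Complex.exp_add]
    congr 2 <;> ring
  have hba : b - a ≠ 0 := sub_ne_zero.2 hab.symm
  rw [Xi, gfun, if_neg hz1, hnum, hlog, Complex.exp_sub, Complex.exp_log]
  · field_simp
    ring
  · exact div_ne_zero (mul_ne_zero (Complex.exp_ne_zero _) hba) hL

lemma exp_Xi_self {a : ℂ} (ha : ‖a‖ < 1) : Complex.exp (Xi a a) = (1 - a)⁻¹ := by
  have hA := one_sub_re_pos ha
  have hA0 : 1 - a ≠ 0 := fun h => by simp [h] at hA
  rw [Xi, div_self hA0, gfun, if_pos rfl,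
    show -(2⁻¹ : ℂ) * Complex.log (1 - a) - 2⁻¹ * Complex.log (1 - a) - 0
      = -Complex.log (1 - a) by ring, Complex.exp_neg, Complex.exp_log hA0]

lemma hasSum_expXiTerm {a b : ℂ} (ha : ‖a‖ < 1) (hb : ‖b‖ < 1) :
    HasSum (fun n => expXiTerm n a b) (Complex.exp (Xi a b)) := by
  rcases eq_or_ne a b with rfl | hab
  · have hterm : (fun n => expXiTerm n a a) = fun n => a ^ n := by
      funext n
      have hn : (n : ℂ) + 1 ≠ 0 := by exact_mod_cast n.succ_ne_zero
      have : ∑ i ∈ range (n + 1), a ^ i * a ^ (n - i) = ∑ i ∈ range (n + 1), a ^ n := by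
        refine Finset.sum_congr rfl fun i hi => ?_
        rw [← pow_add]
        congr 1
        have := Finset.mem_range.1 hi
        omega
      rw [expXiTerm, this, div_eq_iff hn]
      simp
      ring
    rw [exp_Xi_self ha, hterm]
    exact hasSum_geometric_of_norm_lt_one ha
  · have h1 := (hasSum_nat_add_iff' 1).2 (Complex.hasSum_taylorSeries_neg_log ha)
    have h2 := (hasSum_nat_add_iff' 1).2 (Complex.hasSum_taylorSeries_neg_log hb)
    have hab' : a - b ≠ 0 := sub_ne_zero.2 hab
    have h := (h1.sub h2).div_const (a - b)
    have hval : (-Complex.log (1 - a) - ∑ i ∈ range 1, a ^ i / (i : ℂ) -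
        (-Complex.log (1 - b) - ∑ i ∈ range 1, b ^ i / (i : ℂ))) / (a - b)
        = Complex.exp (Xi a b) := by
      rw [div_eq_iff hab', exp_Xi_mul_sub ha hb hab]
      simp
      ring
    have hterm : (fun n : ℕ => (a ^ (n + 1) / ((n + 1 : ℕ) : ℂ) - b ^ (n + 1) / ((n + 1 : ℕ) : ℂ))
        / (a - b)) = fun n => expXiTerm n a b := by
      funext n
      have := geom_sum₂_mul a b (n + 1)
      simp only [Nat.add_sub_cancel] at this
      rw [expXiTerm, div_eq_iff hab', div_mul_eq_mul_div, this]
      push_cast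
      ring
    rw [hval, hterm] at h
    exact h

lemma norm_expXiTerm_le (n : ℕ) (a b : ℂ) :
    ‖expXiTerm n a b‖ ≤ (expXiTerm n (‖a‖ : ℂ) (‖b‖ : ℂ)).re := by
  have h : expXiTerm n (‖a‖ : ℂ) (‖b‖ : ℂ)
      = (((∑ i ∈ range (n + 1), ‖a‖ ^ i * ‖b‖ ^ (n - i)) / (n + 1) : ℝ) : ℂ) := by
    rw [expXiTerm]; push_cast; rfl
  rw [h, Complex.ofReal_re, expXiTerm, norm_div]
  have hn : ‖((n : ℂ) + 1)‖ = n + 1 := by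
    rw [← Nat.cast_succ, Complex.norm_natCast]; push_cast; rfl
  rw [hn]
  gcongr
  refine (norm_sum_le _ _).trans (le_of_eq ?_)
  simp

lemma norm_one_add_le {a : ℂ} {r ξ : ℝ} (hr : 0 ≤ r) (hr1 : r ≤ 1)
    (ha : a = r * Complex.exp (ξ * Complex.I)) :
    ‖1 + a‖ ≤ 1 + r - r / 2 * (1 - Real.cos ξ) := by
  have hc := Real.neg_one_le_cos ξ
  have hc1 := Real.cos_le_one ξ
  have hre : a.re = r * Real.cos ξ := by
    rw [ha, Complex.re_ofReal_mul, Complex.exp_ofReal_mul_I_re]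
  have him : a.im = r * Real.sin ξ := by
    rw [ha, Complex.im_ofReal_mul, Complex.exp_ofReal_mul_I_im]
  have hnn : 0 ≤ 1 + r - r / 2 * (1 - Real.cos ξ) := by nlinarith
  refine abs_le_of_sq_le_sq' ?_ hnn |>.2
  rw [← Complex.normSq_eq_norm_sq, Complex.normSq_apply]
  simp only [Complex.add_re, Complex.one_re, Complex.add_im, Complex.one_im, hre, him]
  have := Real.sin_sq_add_cos_sq ξ
  have h1 : 0 ≤ r * (1 - Real.cos ξ) * (1 - r) :=
    mul_nonneg (mul_nonneg hr (by linarith)) (by linarith)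
  nlinarith [sq_nonneg (r / 2 * (1 - Real.cos ξ))]

lemma norm_exp_Xi_le {a b : ℂ} (ha : ‖a‖ < 1) (hb : ‖b‖ < 1) :
    ‖Complex.exp (Xi a b)‖ ≤
      (Complex.exp (Xi (‖a‖ : ℂ) (‖b‖ : ℂ))).re - (1 + ‖a‖ / 2 + ‖b‖ / 2)
        + (‖1 + a‖ / 2 + ‖1 + b‖ / 2) := by
  have h := hasSum_expXiTerm ha hb
  have h' := Complex.hasSum_re
    (hasSum_expXiTerm (a := (‖a‖ : ℂ)) (b := (‖b‖ : ℂ)) (by simpa using ha) (by simpa using hb))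
  have h2 := (hasSum_nat_add_iff' 2).2 h
  have h2' := (hasSum_nat_add_iff' 2).2 h'
  have hle := h2.norm_le_of_bounded h2' fun n => norm_expXiTerm_le (n + 2) a b
  have e : ∀ u v : ℂ, ∑ i ∈ range 2, expXiTerm i u v = (1 + u) / 2 + (1 + v) / 2 := by
    intro u v
    simp [expXiTerm, Finset.sum_range_succ]
    ring
  have e' : ∑ i ∈ range 2, (expXiTerm i (‖a‖ : ℂ) (‖b‖ : ℂ)).re = 1 + ‖a‖ / 2 + ‖b‖ / 2 := by
    rw [← Complex.re_sum, e]
    simp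
    ring
  rw [e, e'] at hle
  have t1 : ‖Complex.exp (Xi a b)‖ ≤
      ‖Complex.exp (Xi a b) - ((1 + a) / 2 + (1 + b) / 2)‖ + ‖(1 + a) / 2 + (1 + b) / 2‖ := by
    simpa using norm_add_le
      (Complex.exp (Xi a b) - ((1 + a) / 2 + (1 + b) / 2)) ((1 + a) / 2 + (1 + b) / 2)
  have t2 : ‖(1 + a) / 2 + (1 + b) / 2‖ ≤ ‖1 + a‖ / 2 + ‖1 + b‖ / 2 := by
    refine (norm_add_le _ _).trans (le_of_eq ?_)
    simp
  linarith

lemma exp_Xi_ofReal_re {r q : ℝ} (hr : 0 ≤ r) (hr1 : r < 1) (hq : 0 ≤ q) (hq1 : q < 1) :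
    (Complex.exp (Xi r q)).re = Real.exp (Xi r q).re := by
  rw [← Complex.norm_exp]
  have h := hasSum_expXiTerm (a := (r : ℂ)) (b := (q : ℂ))
    (by simpa [abs_of_nonneg hr] using hr1) (by simpa [abs_of_nonneg hq] using hq1)
  have h' := Complex.hasSum_re h
  have hle := h.norm_le_of_bounded h' fun n => by
    simpa [abs_of_nonneg hr, abs_of_nonneg hq] using norm_expXiTerm_le n (r : ℂ) (q : ℂ)
  exact le_antisymm (Complex.re_le_norm _) hle

lemma exp_Xi_ofReal_re_le {r q ρ : ℝ} (hr : 0 ≤ r) (hr1 : r ≤ ρ) (hq : 0 ≤ q) (hq1 : q ≤ ρ)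
    (hρ : ρ < 1) : (Complex.exp (Xi r q)).re ≤ (1 - ρ)⁻¹ := by
  have hρ0 : 0 ≤ ρ := hr.trans hr1
  have h' := Complex.hasSum_re (hasSum_expXiTerm (a := (r : ℂ)) (b := (q : ℂ))
    (by simpa [abs_of_nonneg hr] using hr1.trans_lt hρ)
    (by simpa [abs_of_nonneg hq] using hq1.trans_lt hρ))
  refine hasSum_le (fun n => ?_) h' (hasSum_geometric_of_lt_one hρ0 hρ)
  have h : expXiTerm n (r : ℂ) (q : ℂ)
      = (((∑ i ∈ range (n + 1), r ^ i * q ^ (n - i)) / (n + 1) : ℝ) : ℂ) := by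
    rw [expXiTerm]; push_cast; rfl
  rw [h, Complex.ofReal_re, div_le_iff₀ (by positivity)]
  calc ∑ i ∈ range (n + 1), r ^ i * q ^ (n - i) ≤ ∑ i ∈ range (n + 1), ρ ^ n := by
        refine Finset.sum_le_sum fun i hi => ?_
        have hin : i + (n - i) = n := by
          have := Finset.mem_range.1 hi
          omega
        calc r ^ i * q ^ (n - i) ≤ ρ ^ i * ρ ^ (n - i) := by gcongr
          _ = ρ ^ n := by rw [← pow_add, hin]
    _ = ρ ^ n * (n + 1) := by simp; ring

/-- The decay of `Re Ξ` away from positive real arguments. -/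
lemma Xi_re_sub_le {a b : ℂ} {r q ξ η : ℝ} (hr : 0 ≤ r) (hr1 : r < 1) (hq : 0 ≤ q)
    (hq1 : q < 1) (ha : a = r * Complex.exp (ξ * Complex.I))
    (hb : b = q * Complex.exp (η * Complex.I)) :
    (Xi a b).re - (Xi r q).re ≤
      -((r * (1 - Real.cos ξ) + q * (1 - Real.cos η)) / 4 / (Complex.exp (Xi r q)).re) := by
  have hna : ‖a‖ = r := by
    rw [ha, norm_mul, Complex.norm_exp_ofReal_mul_I]; simp [abs_of_nonneg hr]
  have hnb : ‖b‖ = q := by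
    rw [hb, norm_mul, Complex.norm_exp_ofReal_mul_I]; simp [abs_of_nonneg hq]
  have h := norm_exp_Xi_le (a := a) (b := b) (by rw [hna]; exact hr1) (by rw [hnb]; exact hq1)
  have h1 := norm_one_add_le hr hr1.le ha
  have h2 := norm_one_add_le hq hq1.le hb
  rw [hna, hnb, Complex.norm_exp] at h
  have hG := exp_Xi_ofReal_re hr hr1 hq hq1
  have hpos : 0 < (Complex.exp (Xi r q)).re := hG ▸ Real.exp_pos _
  have h3 := Real.add_one_le_exp ((Xi a b).re - (Xi r q).re)
  rw [Real.exp_sub, ← hG] at h3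
  have h4 : Real.exp (Xi a b).re / (Complex.exp (Xi r q)).re ≤
      1 - (r * (1 - Real.cos ξ) + q * (1 - Real.cos η)) / 4 / (Complex.exp (Xi r q)).re := by
    rw [div_le_iff₀ hpos, sub_mul, div_mul_cancel₀ _ hpos.ne']
    linarith
  linarith

lemma mem_primesLe {y : ℝ} (hy : 0 ≤ y) {p : ℕ} :
    p ∈ primesLe y ↔ (p : ℝ) ≤ y ∧ p.Prime := by
  rw [primesLe, Finset.mem_filter, Finset.mem_Iic, Nat.le_floor_iff hy]

/-- The primes in `(y^{1/4}, y]`. -/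
def largePrimesLe (y : ℝ) : Finset ℕ := (primesLe y).filter fun p : ℕ => y < (p : ℝ) ^ 4

lemma largePrimesLe_nonempty {y : ℝ} (hy : 2 ≤ y) : (largePrimesLe y).Nonempty := by
  have hn : 1 ≤ ⌊y / 2⌋₊ := Nat.le_floor (by push_cast; linarith)
  obtain ⟨p, hp, h1, h2⟩ := Nat.exists_prime_lt_and_le_two_mul ⌊y / 2⌋₊ (by omega)
  have hlt : y / 2 < p := by
    have h3 : (⌊y / 2⌋₊ : ℝ) + 1 ≤ p := by exact_mod_cast h1
    linarith [Nat.lt_floor_add_one (y / 2)]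
  have hle : (p : ℝ) ≤ y := by
    have h3 : (p : ℝ) ≤ 2 * ⌊y / 2⌋₊ := by exact_mod_cast h2
    linarith [Nat.floor_le (show 0 ≤ y / 2 by linarith)]
  have hp2 : (2 : ℝ) ≤ p := by exact_mod_cast hp.two_le
  refine ⟨p, Finset.mem_filter.2 ⟨(mem_primesLe (by linarith)).2 ⟨hle, hp⟩, ?_⟩⟩
  have h8 : (8 : ℝ) ≤ (p : ℝ) ^ 3 := by
    calc (8 : ℝ) = 2 ^ 3 := by norm_num
      _ ≤ _ := by gcongr
  calc y < 8 * p := by linarith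
    _ ≤ (p : ℝ) ^ 3 * p := by gcongr
    _ = (p : ℝ) ^ 4 := by ring

lemma card_primesLe (y : ℝ) : (primesLe y).card = Nat.primeCounting ⌊y⌋₊ := by
  rw [Nat.primeCounting, Nat.primeCounting', Nat.count_eq_card_filter_range, primesLe]
  congr 1
  ext p
  simp

lemma card_small_primes_le {y : ℝ} (hy : 2 ≤ y) :
    (((primesLe y).filter fun p : ℕ => ¬ y < (p : ℝ) ^ 4).card : ℝ) ≤ y ^ (1 / 4 : ℝ) := by
  have hsub : ((primesLe y).filter fun p : ℕ => ¬ y < (p : ℝ) ^ 4) ⊆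
      Finset.Ioc 0 ⌊y ^ (1 / 4 : ℝ)⌋₊ := by
    intro p hp
    rw [Finset.mem_filter, mem_primesLe (by linarith), not_lt] at hp
    rw [Finset.mem_Ioc]
    refine ⟨hp.1.2.pos, Nat.le_floor ?_⟩
    have h : ((p : ℝ) ^ 4) ^ (1 / 4 : ℝ) ≤ y ^ (1 / 4 : ℝ) := by
      gcongr
      exact hp.2
    rwa [← Real.rpow_natCast, ← Real.rpow_mul (by positivity),
      show ((4 : ℕ) : ℝ) * (1 / 4) = 1 by norm_num, Real.rpow_one] at h
  calc (((primesLe y).filter fun p : ℕ => ¬ y < (p : ℝ) ^ 4).card : ℝ)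
      ≤ (Finset.Ioc 0 ⌊y ^ (1 / 4 : ℝ)⌋₊).card := by exact_mod_cast Finset.card_le_card hsub
    _ = ⌊y ^ (1 / 4 : ℝ)⌋₊ := by simp
    _ ≤ y ^ (1 / 4 : ℝ) := Nat.floor_le (by positivity)

lemma eventually_rpow_le_card_largePrimesLe :
    ∀ᶠ y : ℝ in Filter.atTop, y ^ (0.85 : ℝ) ≤ (largePrimesLe y).card := by
  have hlog := (isLittleO_log_rpow_atTop (show (0 : ℝ) < 0.05 by norm_num)).bound
    (show (0 : ℝ) < 1 / 8 by norm_num)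
  filter_upwards [hlog, Filter.eventually_ge_atTop (100 : ℝ)] with y hy hy100
  have hy0 : 0 < y := by linarith
  have hlogpos : 0 < Real.log y := Real.log_pos (by linarith)
  rw [Real.norm_of_nonneg hlogpos.le, Real.norm_of_nonneg (by positivity)] at hy
  have hpi := Chebyshev.pi_ge' (x := y) (by linarith)
  have hnum : y / 4 ≤ (y - 1) * Real.log 2 - Real.log (y + 2) := by
    have h1 : Real.log (y + 2) ≤ (y + 2) / 8 - 1 + Real.log 8 := by
      have := Real.log_le_sub_one_of_pos (show 0 < (y + 2) / 8 by linarith)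
      rw [Real.log_div (by linarith) (by norm_num)] at this
      linarith
    have h8 : Real.log 8 = 3 * Real.log 2 := by
      rw [show (8 : ℝ) = 2 ^ 3 by norm_num, Real.log_pow]; norm_num
    nlinarith [Real.log_two_gt_d9, Real.log_two_lt_d9]
  have hsplit : ((primesLe y).card : ℝ) = (largePrimesLe y).card +
      ((primesLe y).filter fun p : ℕ => ¬ y < (p : ℝ) ^ 4).card := by
    rw [largePrimesLe]
    exact_mod_cast (Finset.card_filter_add_card_filter_not (s := primesLe y)
      (fun p : ℕ => y < (p : ℝ) ^ 4)).symm
  have hsmall := card_small_primes_le (y := y) (by linarith)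
  have hq : y ^ (1 / 4 : ℝ) ≤ y ^ (0.85 : ℝ) :=
    Real.rpow_le_rpow_of_exponent_le (by linarith) (by norm_num)
  have hbig : 2 * y ^ (0.85 : ℝ) ≤ ((primesLe y).card : ℝ) := by
    rw [card_primesLe]
    refine le_trans ?_ hpi
    rw [le_div_iff₀ hlogpos]
    refine le_trans ?_ hnum
    calc 2 * y ^ (0.85 : ℝ) * Real.log y ≤ 2 * y ^ (0.85 : ℝ) * (1 / 8 * y ^ (0.05 : ℝ)) := by
          gcongr
      _ = 1 / 4 * y ^ (0.9 : ℝ) := by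
          rw [show (0.9 : ℝ) = 0.85 + 0.05 by norm_num, Real.rpow_add hy0]; ring
      _ ≤ 1 / 4 * y ^ (1 : ℝ) := by
          gcongr
          · linarith
          · norm_num
      _ = y / 4 := by rw [Real.rpow_one]; ring
  linarith

lemma exists_mul_rpow_le_card_largePrimesLe :
    ∃ c > (0 : ℝ), ∀ y : ℝ, 2 ≤ y → c * y ^ (0.85 : ℝ) ≤ (largePrimesLe y).card := by
  obtain ⟨y₀, hy₀⟩ := Filter.eventually_atTop.1 eventually_rpow_le_card_largePrimesLe
  set Y : ℝ := max y₀ 2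
  have hY : 0 < Y := lt_of_lt_of_le two_pos (le_max_right _ _)
  have hY1 : 1 ≤ Y := one_le_two.trans (le_max_right _ _)
  have hY85 : 1 ≤ Y ^ (0.85 : ℝ) := Real.one_le_rpow hY1 (by norm_num)
  refine ⟨(Y ^ (0.85 : ℝ))⁻¹, by positivity, fun y hy => ?_⟩
  rcases le_total y Y with h | h
  · have hcard : (1 : ℝ) ≤ (largePrimesLe y).card := by
      exact_mod_cast (largePrimesLe_nonempty hy).card_pos
    refine le_trans ?_ hcard
    rw [inv_mul_le_iff₀ (by positivity), mul_one]
    gcongr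
  · refine le_trans ?_ (hy₀ y ((le_max_left _ _).trans h))
    exact mul_le_of_le_one_left (by positivity) (inv_le_one_of_one_le₀ hY85)

/-- The primes in `(y^{1/4}, y]` dominate `∑_{p ≤ y} p^{-σ}`, uniformly for `0 ≤ σ ≤ 0.6`. -/
lemma exists_sum_primesLe_rpow_le :
    ∃ C > (0 : ℝ), ∀ y : ℝ, 2 ≤ y → ∀ σ : ℝ, 0 ≤ σ → σ ≤ 0.6 →
      ∑ p ∈ primesLe y, (p : ℝ) ^ (-σ) ≤ C * ∑ p ∈ largePrimesLe y, (p : ℝ) ^ (-σ) := by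
  obtain ⟨c, hc, h⟩ := exists_mul_rpow_le_card_largePrimesLe
  refine ⟨1 + c⁻¹, by positivity, fun y hy σ hσ0 hσ => ?_⟩
  have hy0 : 0 < y := by linarith
  have hlarge : c * y ^ (1 / 4 : ℝ) ≤ ∑ p ∈ largePrimesLe y, (p : ℝ) ^ (-σ) := by
    calc c * y ^ (1 / 4 : ℝ) = c * y ^ (0.85 : ℝ) * y ^ (-0.6 : ℝ) := by
          rw [mul_assoc, ← Real.rpow_add hy0]; norm_num
      _ ≤ (largePrimesLe y).card * y ^ (-0.6 : ℝ) := by gcongr; exact h y hy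
      _ = ∑ p ∈ largePrimesLe y, y ^ (-0.6 : ℝ) := by simp
      _ ≤ _ := by
          refine Finset.sum_le_sum fun p hp => ?_
          have hp' := (mem_primesLe hy0.le).1 (Finset.mem_filter.1 hp).1
          have hp0 : (0 : ℝ) < p := by exact_mod_cast hp'.2.pos
          calc y ^ (-0.6 : ℝ) ≤ y ^ (-σ) :=
                Real.rpow_le_rpow_of_exponent_le (by linarith) (by linarith)
            _ ≤ (p : ℝ) ^ (-σ) :=
                Real.rpow_le_rpow_of_nonpos hp0 hp'.1 (by linarith)
  have hsmall : ∑ p ∈ (primesLe y).filter (fun p : ℕ => ¬ y < (p : ℝ) ^ 4), (p : ℝ) ^ (-σ)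
      ≤ y ^ (1 / 4 : ℝ) := by
    refine le_trans ?_ (card_small_primes_le hy)
    rw [← nsmul_one, ← Finset.sum_const]
    refine Finset.sum_le_sum fun p hp => ?_
    have hp' := (mem_primesLe hy0.le).1 (Finset.mem_filter.1 hp).1
    exact Real.rpow_le_one_of_one_le_of_nonpos (by exact_mod_cast hp'.2.one_le) (by linarith)
  have hcs : y ^ (1 / 4 : ℝ) ≤ c⁻¹ * ∑ p ∈ largePrimesLe y, (p : ℝ) ^ (-σ) := by
    rw [le_inv_mul_iff₀ hc]; exact hlarge
  rw [← Finset.sum_filter_add_sum_filter_not (primesLe y) (fun p : ℕ => y < (p : ℝ) ^ 4), add_mul,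
    one_mul]
  exact add_le_add le_rfl (hsmall.trans hcs)

lemma div_one_sub_exp_neg_mul_le {l σ : ℝ} (hl : 0 < l) (hσ : 0 < σ) :
    l / (1 - Real.exp (-(σ * l))) ≤ l + 1 / σ := by
  have hx : 0 < σ * l := mul_pos hσ hl
  have h1 : Real.exp (-(σ * l)) ≤ (1 + σ * l)⁻¹ := by
    rw [Real.exp_neg]
    gcongr
    linarith [Real.add_one_le_exp (σ * l)]
  have h2 : σ * l / (1 + σ * l) ≤ 1 - Real.exp (-(σ * l)) := by
    have : σ * l / (1 + σ * l) = 1 - (1 + σ * l)⁻¹ := by field_simp; ring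
    linarith
  calc l / (1 - Real.exp (-(σ * l))) ≤ l / (σ * l / (1 + σ * l)) := by gcongr
    _ = l + 1 / σ := by field_simp; ring

lemma phi2R_le {ε y σ : ℝ} (hε : 0 < ε) (hy : 2 ≤ y) (hσ : ε / Real.log y ≤ σ) :
    phi2R y σ ≤ (1 + 1 / ε) ^ 2 * Real.log y ^ 2 * ∑ p ∈ primesLe y, (p : ℝ) ^ (-σ) := by
  have hL : 0 < Real.log y := Real.log_pos (by linarith)
  have hσ0 : 0 < σ := lt_of_lt_of_le (by positivity) hσ
  rw [phi2R, Finset.mul_sum]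
  refine Finset.sum_le_sum fun p hp => ?_
  have hp' := (mem_primesLe (by linarith)).1 hp
  have hp0 : (0 : ℝ) < p := by exact_mod_cast hp'.2.pos
  have hl : 0 < Real.log p := Real.log_pos (by exact_mod_cast hp'.2.one_lt)
  have hly : Real.log p ≤ Real.log y := Real.log_le_log hp0 hp'.1
  have hinv : 1 / σ ≤ Real.log y / ε := by
    rw [div_le_div_iff₀ hσ0 hε]
    rw [div_le_iff₀ hL] at hσ
    linarith
  have hb := div_one_sub_exp_neg_mul_le hl hσ0
  have hE : Real.exp (-(σ * Real.log p)) = (p : ℝ) ^ (-σ) := by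
    rw [Real.rpow_def_of_pos hp0]; congr 1; ring
  rw [hE] at hb
  have hlt : (p : ℝ) ^ (-σ) < 1 :=
    Real.rpow_lt_one_of_one_lt_of_neg (by exact_mod_cast hp'.2.one_lt) (by linarith)
  have hpos : 0 < (p : ℝ) ^ (-σ) := by positivity
  have heq : Real.log p ^ 2 * (p : ℝ) ^ σ / ((p : ℝ) ^ σ - 1) ^ 2 =
      (Real.log p / (1 - (p : ℝ) ^ (-σ))) ^ 2 * (p : ℝ) ^ (-σ) := by
    have hinv' : (p : ℝ) ^ σ = ((p : ℝ) ^ (-σ))⁻¹ := by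
      rw [Real.rpow_neg hp0.le, inv_inv]
    have h1 : 1 - (p : ℝ) ^ (-σ) ≠ 0 := by linarith
    rw [hinv']
    generalize (p : ℝ) ^ (-σ) = u at *
    have h2 : u⁻¹ - 1 = (1 - u) / u := by field_simp
    rw [h2]
    field_simp
  rw [heq, ← mul_pow]
  refine mul_le_mul_of_nonneg_right (pow_le_pow_left₀ ?_ ?_ 2) hpos.le
  · exact div_nonneg hl.le (sub_nonneg.2 hlt.le)
  · calc _ ≤ Real.log p + 1 / σ := hb
      _ ≤ Real.log y + Real.log y / ε := add_le_add hly hinv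
      _ = _ := by ring

lemma natCast_cpow_neg_add_mul_I {p : ℕ} (hp : 0 < p) (σ τ : ℝ) :
    (p : ℂ) ^ (-((σ : ℂ) + τ * Complex.I)) =
      (((p : ℝ) ^ (-σ) : ℝ) : ℂ) * Complex.exp (((-(τ * Real.log p) : ℝ) : ℂ) * Complex.I) := by
  have hp0 : (p : ℂ) ≠ 0 := by exact_mod_cast hp.ne'
  rw [neg_add, Complex.cpow_add _ _ hp0, Complex.ofReal_cpow (by positivity)]
  congr 1
  · push_cast; rfl
  · rw [Complex.cpow_def_of_ne_zero hp0, ← Complex.natCast_log]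
    congr 1
    push_cast
    ring

lemma sq_div_five_le_one_sub_cos {x : ℝ} (hx : |x| ≤ 1) : x ^ 2 / 5 ≤ 1 - Real.cos x := by
  have hpi := Real.pi_gt_three
  have h := Real.cos_le_one_sub_mul_cos_sq (x := x) (by linarith)
  have h2 : 1 / 5 ≤ 2 / Real.pi ^ 2 := by
    rw [div_le_div_iff₀ (by norm_num) (by positivity)]
    nlinarith [Real.pi_lt_d2]
  nlinarith [mul_le_mul_of_nonneg_right h2 (sq_nonneg x)]

/-- Termwise bound for the primes `p > y^{1/4}`. -/
lemma Xi_re_sub_le_of_large {ε y σ κ τ t : ℝ} (hε : 0 < ε) (hy : 2 ≤ y)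
    (hσ : ε / Real.log y ≤ σ) (hκ : ε / Real.log y ≤ κ) (hτ : |τ| ≤ 1 / Real.log y)
    (ht : |t| ≤ 1 / Real.log y) {p : ℕ} (hp : p ∈ largePrimesLe y) :
    (Xi ((p : ℂ) ^ (-((σ : ℂ) + τ * Complex.I))) ((p : ℂ) ^ (-((κ : ℂ) + t * Complex.I)))).re -
      (Xi (((p : ℝ) ^ (-σ) : ℝ) : ℂ) (((p : ℝ) ^ (-κ) : ℝ) : ℂ)).re ≤
      -((1 - Real.exp (-(ε / 4))) / 320 * Real.log y ^ 2 *
        (τ ^ 2 * (p : ℝ) ^ (-σ) + t ^ 2 * (p : ℝ) ^ (-κ))) := by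
  have hL : 0 < Real.log y := Real.log_pos (by linarith)
  obtain ⟨hp1, hp4⟩ := Finset.mem_filter.1 hp
  have hp' := (mem_primesLe (by linarith)).1 hp1
  have hp0 : (0 : ℝ) < p := by exact_mod_cast hp'.2.pos
  have hl : 0 < Real.log p := Real.log_pos (by exact_mod_cast hp'.2.one_lt)
  have hly : Real.log p ≤ Real.log y := Real.log_le_log hp0 hp'.1
  have hl4 : Real.log y / 4 ≤ Real.log p := by
    have := Real.log_le_log (by linarith) hp4.le
    rw [Real.log_pow] at this
    push_cast at this
    linarith
  have hρ : Real.exp (-(ε / 4)) < 1 := by rw [Real.exp_lt_one_iff]; linarith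
  have hrpow : ∀ s : ℝ, ε / Real.log y ≤ s → (p : ℝ) ^ (-s) ≤ Real.exp (-(ε / 4)) := by
    intro s hs
    rw [Real.rpow_def_of_pos hp0, Real.exp_le_exp]
    rw [div_le_iff₀ hL] at hs
    have hs0 : 0 < s := by
      by_contra hneg
      nlinarith
    nlinarith
  have hcos : ∀ x : ℝ, |x| ≤ 1 / Real.log y →
      x ^ 2 * (Real.log y ^ 2 / 80) ≤ 1 - Real.cos (-(x * Real.log p)) := by
    intro x hx
    have habs : |x * Real.log p| ≤ 1 := by
      rw [abs_mul, abs_of_pos hl]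
      rw [le_div_iff₀ hL] at hx
      exact (mul_le_mul_of_nonneg_left hly (abs_nonneg x)).trans hx
    rw [Real.cos_neg]
    refine le_trans ?_ (sq_div_five_le_one_sub_cos habs)
    have h16 : (Real.log y / 4) ^ 2 ≤ Real.log p ^ 2 := by gcongr
    nlinarith [mul_le_mul_of_nonneg_left h16 (sq_nonneg x)]
  have hr0 : 0 ≤ (p : ℝ) ^ (-σ) := by positivity
  have hq0 : 0 ≤ (p : ℝ) ^ (-κ) := by positivity
  have hr := hrpow σ hσ
  have hq := hrpow κ hκ
  have hmain := Xi_re_sub_le hr0 (hr.trans_lt hρ) hq0 (hq.trans_lt hρ)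
    (natCast_cpow_neg_add_mul_I hp'.2.pos σ τ) (natCast_cpow_neg_add_mul_I hp'.2.pos κ t)
  refine hmain.trans (neg_le_neg ?_)
  have hG := exp_Xi_ofReal_re_le hr0 hr hq0 hq hρ
  have hGpos : 0 < (Complex.exp (Xi (((p : ℝ) ^ (-σ) : ℝ) : ℂ) (((p : ℝ) ^ (-κ) : ℝ) : ℂ))).re := by
    rw [exp_Xi_ofReal_re hr0 (hr.trans_lt hρ) hq0 (hq.trans_lt hρ)]
    exact Real.exp_pos _
  rw [le_div_iff₀ hGpos]
  have hone : (1 - Real.exp (-(ε / 4))) *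
      (Complex.exp (Xi (((p : ℝ) ^ (-σ) : ℝ) : ℂ) (((p : ℝ) ^ (-κ) : ℝ) : ℂ))).re ≤ 1 := by
    rw [← le_div_iff₀' (by linarith), one_div]
    exact hG
  set G := (Complex.exp (Xi (((p : ℝ) ^ (-σ) : ℝ) : ℂ) (((p : ℝ) ^ (-κ) : ℝ) : ℂ))).re
  have hnn : 0 ≤ Real.log y ^ 2 / 320 * (τ ^ 2 * (p : ℝ) ^ (-σ) + t ^ 2 * (p : ℝ) ^ (-κ)) := by
    positivity
  calc _ = (1 - Real.exp (-(ε / 4))) * G *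
        (Real.log y ^ 2 / 320 * (τ ^ 2 * (p : ℝ) ^ (-σ) + t ^ 2 * (p : ℝ) ^ (-κ))) := by ring
    _ ≤ 1 * (Real.log y ^ 2 / 320 * (τ ^ 2 * (p : ℝ) ^ (-σ) + t ^ 2 * (p : ℝ) ^ (-κ))) := by
        gcongr
    _ ≤ _ := by
        have a1 := mul_le_mul_of_nonneg_left (hcos τ hτ) hr0
        have a2 := mul_le_mul_of_nonneg_left (hcos t ht) hq0
        linarith

/-- For any prime, passing to positive real arguments does not decrease `Re Ξ`. -/
lemma Xi_re_sub_nonpos {p : ℕ} (hp : p.Prime) {σ κ : ℝ} (hσ : 0 < σ) (hκ : 0 < κ) (τ t : ℝ) :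
    (Xi ((p : ℂ) ^ (-((σ : ℂ) + τ * Complex.I))) ((p : ℂ) ^ (-((κ : ℂ) + t * Complex.I)))).re -
      (Xi (((p : ℝ) ^ (-σ) : ℝ) : ℂ) (((p : ℝ) ^ (-κ) : ℝ) : ℂ)).re ≤ 0 := by
  have hp1 : (1 : ℝ) < p := by exact_mod_cast hp.one_lt
  have hr0 : 0 ≤ (p : ℝ) ^ (-σ) := by positivity
  have hq0 : 0 ≤ (p : ℝ) ^ (-κ) := by positivity
  have hr := Real.rpow_lt_one_of_one_lt_of_neg hp1 (neg_lt_zero.2 hσ)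
  have hq := Real.rpow_lt_one_of_one_lt_of_neg hp1 (neg_lt_zero.2 hκ)
  refine (Xi_re_sub_le hr0 hr hq0 hq (natCast_cpow_neg_add_mul_I hp.pos σ τ)
    (natCast_cpow_neg_add_mul_I hp.pos κ t)).trans (neg_nonpos.2 ?_)
  rw [exp_Xi_ofReal_re hr0 hr hq0 hq]
  have h1 : 0 ≤ 1 - Real.cos (-(τ * Real.log p)) := sub_nonneg.2 (Real.cos_le_one _)
  have h2 : 0 ≤ 1 - Real.cos (-(t * Real.log p)) := sub_nonneg.2 (Real.cos_le_one _)
  positivity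

lemma fy_re_sub_le {ε y σ κ τ t : ℝ} (hε : 0 < ε) (hy : 2 ≤ y)
    (hσ : ε / Real.log y ≤ σ) (hκ : ε / Real.log y ≤ κ) (hτ : |τ| ≤ 1 / Real.log y)
    (ht : |t| ≤ 1 / Real.log y) :
    (fy y ((σ : ℂ) + (τ : ℂ) * Complex.I) ((κ : ℂ) + (t : ℂ) * Complex.I) -
      fy y (σ : ℂ) (κ : ℂ)).re ≤
      -((1 - Real.exp (-(ε / 4))) / 320 * Real.log y ^ 2 *
        (τ ^ 2 * ∑ p ∈ largePrimesLe y, (p : ℝ) ^ (-σ) +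
          t ^ 2 * ∑ p ∈ largePrimesLe y, (p : ℝ) ^ (-κ))) := by
  have hL : 0 < Real.log y := Real.log_pos (by linarith)
  have hε' : 0 < ε / Real.log y := by positivity
  have hreal : ∀ (p : ℕ) (s : ℝ), (p : ℂ) ^ (-(s : ℂ)) = (((p : ℝ) ^ (-s) : ℝ) : ℂ) := by
    intro p s
    rw [Complex.ofReal_cpow (by positivity)]
    push_cast
    rfl
  simp only [fy, ← Finset.sum_sub_distrib, Complex.re_sum, Complex.sub_re, hreal]
  rw [← Finset.sum_filter_add_sum_filter_not (primesLe y) (fun p : ℕ => y < (p : ℝ) ^ 4)]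
  have hsmall : ∑ p ∈ (primesLe y).filter (fun p : ℕ => ¬ y < (p : ℝ) ^ 4),
      ((Xi ((p : ℂ) ^ (-((σ : ℂ) + τ * Complex.I))) ((p : ℂ) ^ (-((κ : ℂ) + t * Complex.I)))).re -
      (Xi (((p : ℝ) ^ (-σ) : ℝ) : ℂ) (((p : ℝ) ^ (-κ) : ℝ) : ℂ)).re) ≤ 0 :=
    Finset.sum_nonpos fun p hp => Xi_re_sub_nonpos
      ((mem_primesLe (by linarith)).1 (Finset.mem_filter.1 hp).1).2
      (hε'.trans_le hσ) (hε'.trans_le hκ) τ t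
  have hlarge := Finset.sum_le_sum fun p (hp : p ∈ largePrimesLe y) =>
    Xi_re_sub_le_of_large hε hy hσ hκ hτ ht hp
  refine (add_le_add hlarge hsmall).trans (le_of_eq ?_)
  rw [add_zero, Finset.sum_neg_distrib, ← Finset.mul_sum, Finset.sum_add_distrib,
    ← Finset.mul_sum, ← Finset.mul_sum]

/-- Lemma 5.(iii). -/
theorem stmt14 :
    ∀ ε > (0 : ℝ), ∃ c₂ > (0 : ℝ), ∀ y : ℝ, 2 ≤ y → ∀ σ κ τ t : ℝ,
      ε / Real.log y ≤ min σ κ → max σ κ ≤ 0.6 →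
      max |τ| |t| ≤ c₂ / Real.log y →
      (fy y ((σ : ℂ) + (τ : ℂ) * Complex.I) ((κ : ℂ) + (t : ℂ) * Complex.I) -
          fy y (σ : ℂ) (κ : ℂ)).re ≤
        -(c₂ * (τ ^ 2 * phi2R y σ + t ^ 2 * phi2R y κ)) := by
  intro ε hε
  obtain ⟨C, hC, hsum⟩ := exists_sum_primesLe_rpow_le
  have hρ : 0 < 1 - Real.exp (-(ε / 4)) := by
    rw [sub_pos, Real.exp_lt_one_iff]
    linarith
  set K : ℝ := (1 + 1 / ε) ^ 2 * C with hK
  have hKpos : 0 < K := by positivity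
  refine ⟨min 1 ((1 - Real.exp (-(ε / 4))) / 320 / K), by positivity, ?_⟩
  intro y hy σ κ τ t hmin hmax hmaxabs
  set c₂ := min 1 ((1 - Real.exp (-(ε / 4))) / 320 / K) with hc₂
  have hc₂0 : 0 < c₂ := by positivity
  have hL : 0 < Real.log y := Real.log_pos (by linarith)
  obtain ⟨hσ, hκ⟩ := le_min_iff.1 hmin
  obtain ⟨hσ6, hκ6⟩ := max_le_iff.1 hmax
  have hone : c₂ / Real.log y ≤ 1 / Real.log y := by
    gcongr
    exact min_le_left _ _
  obtain ⟨hτ, ht⟩ := max_le_iff.1 (hmaxabs.trans hone)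
  refine (fy_re_sub_le hε hy hσ hκ hτ ht).trans (neg_le_neg ?_)
  have hphi : ∀ s : ℝ, ε / Real.log y ≤ s → s ≤ 0.6 → c₂ * phi2R y s ≤
      (1 - Real.exp (-(ε / 4))) / 320 * Real.log y ^ 2 *
        ∑ p ∈ largePrimesLe y, (p : ℝ) ^ (-s) := by
    intro s hs hs6
    have hs0 : 0 ≤ s := le_trans (by positivity) hs
    have hS : 0 ≤ ∑ p ∈ largePrimesLe y, (p : ℝ) ^ (-s) :=
      Finset.sum_nonneg fun p _ => by positivity
    have hcK : c₂ * K ≤ (1 - Real.exp (-(ε / 4))) / 320 := by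
      rw [← le_div_iff₀ hKpos]
      exact min_le_right _ _
    calc c₂ * phi2R y s ≤ c₂ * ((1 + 1 / ε) ^ 2 * Real.log y ^ 2 *
          (C * ∑ p ∈ largePrimesLe y, (p : ℝ) ^ (-s))) := by
          gcongr
          refine (phi2R_le hε hy hs).trans ?_
          gcongr
          exact hsum y hy s hs0 hs6
      _ = c₂ * K * (Real.log y ^ 2 * ∑ p ∈ largePrimesLe y, (p : ℝ) ^ (-s)) := by
          rw [hK]; ring
      _ ≤ (1 - Real.exp (-(ε / 4))) / 320 *
          (Real.log y ^ 2 * ∑ p ∈ largePrimesLe y, (p : ℝ) ^ (-s)) := by gcongr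
      _ = _ := by ring
  have h1 := mul_le_mul_of_nonneg_left (hphi σ hσ hσ6) (sq_nonneg τ)
  have h2 := mul_le_mul_of_nonneg_left (hphi κ hκ hκ6) (sq_nonneg t)
  linarith

end
end
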